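/- Let φ be a 3-form on ℝ⁶ with λ_φ < 0. Then the standard symplectic form ω is invariant under the Hitchin almost complex structure J_φ, i.e. ω(J_φ x, J_φ y) = ω(x, y) for all x, y ∈ ℝ⁶, if and only if φ is primitive, i.e. ω ∧ φ = 0. -/

import Mathlib

noncomputable section

/-- The underlying vector space `V = ℝ⁶`. -/
abbrev V6 : Type := Fin 6 → ℝ

/-- The standard basis of `ℝ⁶`. -/
def e6 (i : Fin 6) : V6 := fun j => if j = i then (1 : ℝ) else 0

/-- The standard symplectic form `ω = e¹∧e² + e³∧e⁴ + e⁵∧e⁶`. -/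
def ω6 (x y : V6) : ℝ :=
  x 0 * y 1 - x 1 * y 0 + x 2 * y 3 - x 3 * y 2 + x 4 * y 5 - x 5 * y 4

/-- Wedge product of a 2-form and a 3-form (standard convention `1/(2!·3!)`). -/
def wedge23 (a : V6 → V6 → ℝ) (b : V6 → V6 → V6 → ℝ) (v : Fin 5 → V6) : ℝ :=
  (1 / 12 : ℝ) * ∑ σ : Equiv.Perm (Fin 5),
    ((Equiv.Perm.sign σ : ℤ) : ℝ) *
      (a (v (σ 0)) (v (σ 1)) * b (v (σ 2)) (v (σ 3)) (v (σ 4)))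

/-- Hitchin's map `K_φ`, characterized by `ι_{K_φ v} vol = -(ι_v φ) ∧ φ` (here written out
in components using the volume form `vol = e¹∧⋯∧e⁶`). -/
def Kmap (φ : V6 → V6 → V6 → ℝ) (x : V6) : V6 := fun i =>
  (-1 : ℝ) ^ (i : ℕ) *
    (-(wedge23 (fun y z => φ x y z) φ (fun j => e6 (i.succAbove j))))

/-- Hitchin's invariant `λ_φ = (1/6)·tr(K_φ²)`. -/
def lamH (φ : V6 → V6 → V6 → ℝ) : ℝ :=
  (1 / 6 : ℝ) * ∑ i : Fin 6, Kmap φ (Kmap φ (e6 i)) i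

/-- Hitchin's almost complex structure `J_φ = K_φ / √(-λ_φ)`. -/
def Jmap (φ : V6 → V6 → V6 → ℝ) (x : V6) : V6 :=
  (Real.sqrt (-(lamH φ)))⁻¹ • Kmap φ x

/-- A 3-form, viewed as a trilinear function of vectors. -/
def ap3 (φ : AlternatingMap ℝ V6 ℝ (Fin 3)) : V6 → V6 → V6 → ℝ :=
  fun x y z => φ ![x, y, z]

open Equiv in
theorem sum_perm_fin_five_wedge (a : Fin 5 → Fin 5 → ℝ) (b : Fin 5 → Fin 5 → Fin 5 → ℝ)
    (ha : ∀ i j, a j i = -a i j) (hb₁ : ∀ i j k, b j i k = -b i j k)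
    (hb₂ : ∀ i j k, b i k j = -b i j k) :
    ∑ σ : Perm (Fin 5), ((Perm.sign σ : ℤ) : ℝ) * (a (σ 0) (σ 1) * b (σ 2) (σ 3) (σ 4)) =
      12 * (a 0 1 * b 2 3 4 - a 0 2 * b 1 3 4 + a 0 3 * b 1 2 4 - a 0 4 * b 1 2 3
        + a 1 2 * b 0 3 4 - a 1 3 * b 0 2 4 + a 1 4 * b 0 2 3
        + a 2 3 * b 0 1 4 - a 2 4 * b 0 1 3 + a 3 4 * b 0 1 2) := by
  have key : ∀ (n : ℕ) (f : Perm (Fin (n + 1)) → ℝ),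
      ∑ σ, f σ = ∑ p, ∑ σ, f (Perm.decomposeFin.symm (p, σ)) := fun n f => by
    rw [← Perm.decomposeFin.symm.sum_comp, Fintype.sum_prod_type]
  have ha' : ∀ i j, j < i → a i j = -a j i := fun i j _ => ha j i
  have hb₁' : ∀ i j k, j < i → b i j k = -b j i k := fun i j k _ => hb₁ j i k
  have hb₂' : ∀ i j k, k < j → b i j k = -b i k j := fun i j k _ => hb₂ i k j
  have h2 : (2 : Fin 5) = Fin.succ (Fin.succ 0) := rfl
  have h3 : (3 : Fin 5) = Fin.succ (Fin.succ (Fin.succ 0)) := rfl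
  have h4 : (4 : Fin 5) = Fin.succ (Fin.succ (Fin.succ (Fin.succ 0))) := rfl
  have h1 : (1 : Fin 5) = Fin.succ 0 := rfl
  rw [key]
  simp_rw [key]
  simp only [h1, h2, h3, h4, Perm.decomposeFin.symm_sign, Perm.decomposeFin_symm_apply_zero,
    Perm.decomposeFin_symm_apply_succ, Fin.sum_univ_succ, Finset.univ_unique, Finset.sum_singleton]
  simp [swap_apply_def, -Fin.succ_zero_eq_one, -Fin.succ_one_eq_two]
  simp (disch := decide) only [ha', hb₁', hb₂']
  ring

theorem wedge23_eq (a : V6 → V6 → ℝ) (b : V6 → V6 → V6 → ℝ)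
    (ha : ∀ x y, a y x = -a x y) (hb₁ : ∀ x y z, b y x z = -b x y z)
    (hb₂ : ∀ x y z, b x z y = -b x y z) (v : Fin 5 → V6) :
    wedge23 a b v =
      a (v 0) (v 1) * b (v 2) (v 3) (v 4) - a (v 0) (v 2) * b (v 1) (v 3) (v 4)
        + a (v 0) (v 3) * b (v 1) (v 2) (v 4) - a (v 0) (v 4) * b (v 1) (v 2) (v 3)
        + a (v 1) (v 2) * b (v 0) (v 3) (v 4) - a (v 1) (v 3) * b (v 0) (v 2) (v 4)
        + a (v 1) (v 4) * b (v 0) (v 2) (v 3) + a (v 2) (v 3) * b (v 0) (v 1) (v 4)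
        - a (v 2) (v 4) * b (v 0) (v 1) (v 3) + a (v 3) (v 4) * b (v 0) (v 1) (v 2) := by
  rw [wedge23, sum_perm_fin_five_wedge (fun i j => a (v i) (v j))
    (fun i j k => b (v i) (v j) (v k)) (fun _ _ => ha _ _) (fun _ _ _ => hb₁ _ _ _)
    (fun _ _ _ => hb₂ _ _ _)]
  ring

theorem e6_apply (i j : Fin 6) : e6 i j = if j = i then 1 else 0 := rfl

section ap3

variable (φ : AlternatingMap ℝ V6 ℝ (Fin 3))

theorem ap3_swap_left (x y z : V6) : ap3 φ y x z = -ap3 φ x y z := by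
  have h := φ.map_swap ![x, y, z] (show (0 : Fin 3) ≠ 1 by decide)
  rw [ap3, ap3, ← h]
  congr 1
  ext i : 1
  fin_cases i <;> rfl

theorem ap3_swap_right (x y z : V6) : ap3 φ x z y = -ap3 φ x y z := by
  have h := φ.map_swap ![x, y, z] (show (1 : Fin 3) ≠ 2 by decide)
  rw [ap3, ap3, ← h]
  congr 1
  ext i : 1
  fin_cases i <;> rfl

theorem ap3_self_left (x y : V6) : ap3 φ x x y = 0 := by
  linarith [ap3_swap_left φ x x y]

theorem ap3_self_right (x y : V6) : ap3 φ x y y = 0 := by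
  linarith [ap3_swap_right φ x y y]

theorem ap3_add_left (x x' y z : V6) : ap3 φ (x + x') y z = ap3 φ x y z + ap3 φ x' y z :=
  φ.toMultilinearMap.cons_add ![y, z] x x'

theorem ap3_smul_left (c : ℝ) (x y z : V6) : ap3 φ (c • x) y z = c * ap3 φ x y z :=
  φ.toMultilinearMap.cons_smul ![y, z] c x

theorem ap3_add_middle (x y y' z : V6) : ap3 φ x (y + y') z = ap3 φ x y z + ap3 φ x y' z := by
  rw [ap3_swap_left, ap3_add_left, ap3_swap_left φ x y, ap3_swap_left φ x y']; ring

theorem ap3_smul_middle (c : ℝ) (x y z : V6) : ap3 φ x (c • y) z = c * ap3 φ x y z := by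
  rw [ap3_swap_left, ap3_smul_left, ap3_swap_left φ x y]; ring

theorem ap3_add_right (x y z z' : V6) : ap3 φ x y (z + z') = ap3 φ x y z + ap3 φ x y z' := by
  rw [ap3_swap_right, ap3_add_middle, ap3_swap_right φ x y z, ap3_swap_right φ x y z']; ring

theorem ap3_smul_right (c : ℝ) (x y z : V6) : ap3 φ x y (c • z) = c * ap3 φ x y z := by
  rw [ap3_swap_right, ap3_smul_middle, ap3_swap_right φ x y z]; ring

/-- Hitchin's map `K_φ` as a linear endomorphism. -/
def hitchinK : V6 →ₗ[ℝ] V6 where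
  toFun := Kmap (ap3 φ)
  map_add' x y := by
    ext i
    simp only [Kmap, wedge23, ap3_add_left, add_mul, mul_add, Finset.sum_add_distrib,
      Pi.add_apply]
    ring
  map_smul' c x := by
    ext i
    simp only [Kmap, wedge23, ap3_smul_left, Pi.smul_apply, smul_eq_mul, RingHom.id_apply,
      Finset.mul_sum, ← Finset.sum_neg_distrib]
    exact Finset.sum_congr rfl fun σ _ => by ring

theorem sum_smul_e6 (x : V6) : ∑ i, x i • e6 i = x := by
  ext j
  simp [e6, Finset.sum_apply]

theorem hitchinK_apply (x : V6) (i : Fin 6) :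
    hitchinK φ x i = ∑ j, x j * hitchinK φ (e6 j) i := by
  conv_lhs => rw [← sum_smul_e6 x]
  simp [Finset.sum_apply]

/-- The matrix entry `K_φ(e_j)_i` in terms of the coefficients of `φ`. -/
theorem hitchinK_e6_apply (i j : Fin 6) : hitchinK φ (e6 j) i =
    (-1) ^ (i : ℕ) * -(wedge23 (ap3 φ (e6 j)) (ap3 φ) fun k => e6 (i.succAbove k)) := rfl

/-- The vector dual to the 5-form `ω ∧ φ` with respect to the volume form. -/
def lefschetzVec : V6 := fun i =>
  (-1) ^ (i : ℕ) * wedge23 ω6 (ap3 φ) fun k => e6 (i.succAbove k)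

theorem ω6_swap (x y : V6) : ω6 y x = -ω6 x y := by
  simp only [ω6]; ring

/-- The standard symplectic form as a bilinear map. -/
def ω6Bilin : V6 →ₗ[ℝ] V6 →ₗ[ℝ] ℝ :=
  LinearMap.mk₂ ℝ ω6
    (fun x y z => by simp only [ω6, Pi.add_apply]; ring)
    (fun c x y => by simp only [ω6, Pi.smul_apply, smul_eq_mul]; ring)
    (fun x y z => by simp only [ω6, Pi.add_apply]; ring)
    (fun c x y => by simp only [ω6, Pi.smul_apply, smul_eq_mul]; ring)

/-- The contraction of a 3-form with a vector, as a bilinear map. -/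
def contractBilin (θ : V6) : V6 →ₗ[ℝ] V6 →ₗ[ℝ] ℝ :=
  LinearMap.mk₂ ℝ (ap3 φ θ) (ap3_add_middle φ θ) (fun c => ap3_smul_middle φ c θ)
    (ap3_add_right φ θ) (fun c => ap3_smul_right φ c θ)

theorem basisFun_eq_e6 (i : Fin 6) : Pi.basisFun ℝ (Fin 6) i = e6 i := by
  ext j
  simp [e6, Pi.single_apply]

theorem ap3_e6_swap_left {i j : Fin 6} (_ : j < i) (x : V6) :
    ap3 φ (e6 i) (e6 j) x = -ap3 φ (e6 j) (e6 i) x := ap3_swap_left ..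

theorem ap3_e6_swap_right (x : V6) {j k : Fin 6} (_ : k < j) :
    ap3 φ x (e6 j) (e6 k) = -ap3 φ x (e6 k) (e6 j) := ap3_swap_right ..

theorem ap3_lefschetzVec (y z : V6) :
    ap3 φ (lefschetzVec φ) y z = ∑ i, lefschetzVec φ i * ap3 φ (e6 i) y z := by
  have h (s : Finset (Fin 6)) : ap3 φ (∑ i ∈ s, lefschetzVec φ i • e6 i) y z =
      ∑ i ∈ s, lefschetzVec φ i * ap3 φ (e6 i) y z := by
    induction s using Finset.induction_on with
    | empty => simpa using ap3_smul_left φ 0 0 y z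
    | insert i s hi ih => rw [Finset.sum_insert hi, Finset.sum_insert hi, ap3_add_left,
        ap3_smul_left, ih]
  rw [← h, sum_smul_e6]

set_option maxHeartbeats 4000000 in
theorem hitchinK_hitchinK_offdiag (i j : Fin 6) (hij : i ≠ j) :
    hitchinK φ (hitchinK φ (e6 j)) i = 0 := by
  rw [hitchinK_apply]
  simp only [hitchinK_e6_apply, wedge23_eq _ _ (ap3_swap_right φ _) (ap3_swap_left φ)
    (ap3_swap_right φ)]
  fin_cases i <;> fin_cases j <;> first
    | exact absurd rfl hij
    | simp [Fin.sum_univ_six, Fin.succAbove]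
      simp (disch := decide) only [ap3_e6_swap_left, ap3_e6_swap_right, ap3_self_left,
        ap3_self_right]
      ring

set_option maxHeartbeats 4000000 in
theorem hitchinK_hitchinK_diag (i : Fin 6) :
    hitchinK φ (hitchinK φ (e6 i)) i = hitchinK φ (hitchinK φ (e6 0)) 0 := by
  rw [hitchinK_apply, hitchinK_apply φ (hitchinK φ (e6 0))]
  simp only [hitchinK_e6_apply, wedge23_eq _ _ (ap3_swap_right φ _) (ap3_swap_left φ)
    (ap3_swap_right φ)]
  fin_cases i <;> first
    | rfl
    | simp [Fin.sum_univ_six, Fin.succAbove]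
      simp (disch := decide) only [ap3_e6_swap_left, ap3_e6_swap_right, ap3_self_left,
        ap3_self_right]
      ring

theorem hitchinK_comp_self (x : V6) :
    hitchinK φ (hitchinK φ x) = lamH (ap3 φ) • x := by
  have hlam : lamH (ap3 φ) = hitchinK φ (hitchinK φ (e6 0)) 0 := by
    have h : lamH (ap3 φ) = (1 / 6 : ℝ) * ∑ i, hitchinK φ (hitchinK φ (e6 i)) i := rfl
    rw [h, Finset.sum_congr rfl fun i _ => hitchinK_hitchinK_diag φ i]
    simp
  suffices h : hitchinK φ ∘ₗ hitchinK φ = lamH (ap3 φ) • LinearMap.id from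
    LinearMap.congr_fun h x
  refine (Pi.basisFun ℝ (Fin 6)).ext fun j => ?_
  ext i
  rw [basisFun_eq_e6, LinearMap.comp_apply, LinearMap.smul_apply, LinearMap.id_apply,
    Pi.smul_apply, smul_eq_mul]
  by_cases hij : i = j
  · subst hij
    simp [hlam, hitchinK_hitchinK_diag φ i, e6]
  · simp [hitchinK_hitchinK_offdiag φ i j hij, e6, hij]

set_option maxHeartbeats 4000000 in
/-- The failure of `K_φ` to lie in `𝔰𝔭(6)` is the contraction of `φ` with the vector dual to
`ω ∧ φ`. -/
theorem ω6_hitchinK_add (x y : V6) :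
    ω6 (hitchinK φ x) y + ω6 x (hitchinK φ y) = -2 * ap3 φ (lefschetzVec φ) x y := by
  suffices h : ω6Bilin ∘ₗ hitchinK φ + ω6Bilin.compl₂ (hitchinK φ) =
      (-2 : ℝ) • contractBilin φ (lefschetzVec φ) from
    LinearMap.congr_fun₂ h x y
  refine LinearMap.ext_basis (Pi.basisFun ℝ (Fin 6)) (Pi.basisFun ℝ (Fin 6)) fun i j => ?_
  rw [basisFun_eq_e6, basisFun_eq_e6]
  change ω6 (hitchinK φ (e6 i)) (e6 j) + ω6 (e6 i) (hitchinK φ (e6 j)) =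
    -2 * ap3 φ (lefschetzVec φ) (e6 i) (e6 j)
  simp only [ap3_lefschetzVec, ω6, hitchinK_e6_apply, lefschetzVec,
    wedge23_eq _ _ (ap3_swap_right φ _) (ap3_swap_left φ) (ap3_swap_right φ),
    wedge23_eq ω6 _ ω6_swap (ap3_swap_left φ) (ap3_swap_right φ)]
  fin_cases i <;> fin_cases j <;>
  · simp [Fin.sum_univ_six, Fin.succAbove, e6_apply]
    simp (disch := decide) only [ap3_e6_swap_left, ap3_e6_swap_right, ap3_self_left,
      ap3_self_right]
    ring

end ap3

/-- The multilinear map `v ↦ a(v₀, v₁) b(v₂, v₃, v₄)` whose alternatization is `12 • (ω ∧ φ)`. -/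
def ω6MulForm (φ : AlternatingMap ℝ V6 ℝ (Fin 3)) : MultilinearMap ℝ (fun _ : Fin 5 => V6) ℝ :=
  MultilinearMap.mk' (fun v => ω6Bilin (v 0) (v 1) * ap3 φ (v 2) (v 3) (v 4))
    (fun v i x y => by
      fin_cases i <;> simp [Function.update, ap3_add_left, ap3_add_middle, ap3_add_right] <;> ring)
    (fun v i c x => by
      fin_cases i <;>
        simp [Function.update, ap3_smul_left, ap3_smul_middle, ap3_smul_right] <;> ring)

theorem wedge23_ω6_eq_alternatization (φ : AlternatingMap ℝ V6 ℝ (Fin 3)) (v : Fin 5 → V6) :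
    wedge23 ω6 (ap3 φ) v = (1 / 12 : ℝ) * MultilinearMap.alternatization (ω6MulForm φ) v := by
  rw [MultilinearMap.alternatization_apply, wedge23]
  congr 1
  refine Finset.sum_congr rfl fun σ _ => ?_
  rw [Units.smul_def, zsmul_eq_mul]
  rfl

/-- An alternating 5-form on `ℝ⁶` vanishing on the five-element subfamilies of the standard basis
vanishes. -/
theorem alternating_eq_zero_of_succAbove (A : AlternatingMap ℝ V6 ℝ (Fin 5))
    (h : ∀ i : Fin 6, A (fun k => e6 (i.succAbove k)) = 0) : A = 0 := by
  refine (Pi.basisFun ℝ (Fin 6)).ext_alternating fun f hf => ?_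
  obtain ⟨i, hi⟩ : ∃ i, ∀ k, f k ≠ i := by
    by_contra! hc
    simpa using Fintype.card_le_of_surjective f hc
  choose σ hσ using fun k => Fin.exists_succAbove_eq (hi k)
  have hσi : Function.Injective σ := fun a b hab => hf (by rw [← hσ a, ← hσ b, hab])
  have hA := A.map_perm (fun k => e6 (i.succAbove k))
    (Equiv.ofBijective σ hσi.bijective_of_finite)
  simp_rw [basisFun_eq_e6, ← hσ]
  simpa [h i, Function.comp_def] using hA

theorem lefschetzVec_eq_zero_iff (φ : AlternatingMap ℝ V6 ℝ (Fin 3)) :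
    lefschetzVec φ = 0 ↔ ∀ v : Fin 5 → V6, wedge23 ω6 (ap3 φ) v = 0 := by
  refine ⟨fun h v => ?_, fun h => funext fun i => by simp [lefschetzVec, h]⟩
  have hA : MultilinearMap.alternatization (ω6MulForm φ) = 0 := by
    refine alternating_eq_zero_of_succAbove _ fun i => ?_
    have hi : (-1 : ℝ) ^ (i : ℕ) * wedge23 ω6 (ap3 φ) (fun k => e6 (i.succAbove k)) = 0 :=
      congrFun h i
    rw [wedge23_ω6_eq_alternatization] at hi
    simpa using hi
  rw [wedge23_ω6_eq_alternatization, hA, AlternatingMap.zero_apply, mul_zero]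

theorem ap3_lefschetzVec_eq_zero_iff (φ : AlternatingMap ℝ V6 ℝ (Fin 3))
    (hlam : lamH (ap3 φ) ≠ 0) :
    (∀ x y, ap3 φ (lefschetzVec φ) x y = 0) ↔ lefschetzVec φ = 0 := by
  refine ⟨fun h => ?_, fun h x y => ?_⟩
  · have hK : hitchinK φ (lefschetzVec φ) = 0 := by
      ext i
      change Kmap (ap3 φ) (lefschetzVec φ) i = 0
      simp [Kmap, wedge23, h]
    have h2 := hitchinK_comp_self φ (lefschetzVec φ)
    rw [hK, map_zero] at h2
    exact (smul_eq_zero.mp h2.symm).resolve_left hlam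
  · simpa [h] using ap3_smul_left φ 0 0 x y

theorem ω6_smul_smul (c : ℝ) (x y : V6) : ω6 (c • x) (c • y) = c ^ 2 * ω6 x y := by
  simp only [ω6, Pi.smul_apply, smul_eq_mul]; ring

theorem ω6_Jmap_invariant_iff (φ : AlternatingMap ℝ V6 ℝ (Fin 3)) (hlam : lamH (ap3 φ) < 0) :
    (∀ x y : V6, ω6 (Jmap (ap3 φ) x) (Jmap (ap3 φ) y) = ω6 x y) ↔
      ∀ x y, ω6 (hitchinK φ x) y + ω6 x (hitchinK φ y) = 0 := by
  have hJ : ∀ x y, ω6 (Jmap (ap3 φ) x) (Jmap (ap3 φ) y) =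
      (-lamH (ap3 φ))⁻¹ * ω6 (hitchinK φ x) (hitchinK φ y) := fun x y => by
    rw [← Real.sq_sqrt (neg_pos.mpr hlam).le, ← inv_pow]
    exact ω6_smul_smul ..
  have hsmul : ∀ x y, ω6 x (lamH (ap3 φ) • y) = lamH (ap3 φ) * ω6 x y :=
    fun x y => (ω6Bilin x).map_smul _ y
  simp_rw [hJ, inv_mul_eq_iff_eq_mul₀ (neg_ne_zero.mpr hlam.ne)]
  refine ⟨fun h x y => ?_, fun h x y => ?_⟩
  · have hy := h x (hitchinK φ y)
    rw [hitchinK_comp_self, hsmul] at hy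
    exact (mul_eq_zero.mp (by linear_combination hy)).resolve_left hlam.ne
  · have hy := h x (hitchinK φ y)
    rw [hitchinK_comp_self, hsmul] at hy
    linear_combination hy

/-- For a 3-form φ on ℝ⁶ with λ_φ < 0, the standard symplectic form ω is
invariant under the Hitchin almost complex structure `J_φ` if and only if φ is primitive,
i.e. `ω ∧ φ = 0`. -/
theorem omega_Jinvariant_iff_primitive (φ : AlternatingMap ℝ V6 ℝ (Fin 3))
    (hlam : lamH (ap3 φ) < 0) :
    (∀ x y : V6, ω6 (Jmap (ap3 φ) x) (Jmap (ap3 φ) y) = ω6 x y) ↔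
      (∀ v : Fin 5 → V6, wedge23 ω6 (ap3 φ) v = 0) := by
  rw [ω6_Jmap_invariant_iff φ hlam, ← lefschetzVec_eq_zero_iff,
    ← ap3_lefschetzVec_eq_zero_iff φ hlam.ne]
  simp_rw [ω6_hitchinK_add]
  simp
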